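/- arXiv:2106.05996 — 2 statements merged into one kernel-verified Lean document; each statement's English description precedes it below -/
import Mathlib

section
/- Let b and x be real numbers with 0 < b ≤ 1 and 1/2 < x ≤ 1. Let n ≥ 0 be an integer, let f_1, …, f_n be nonnegative real numbers with f_1 + ⋯ + f_n < 1, and let y_1, …, y_n be real numbers with 1 − x ≤ y_j < 1/2 for every j. Then ∏_{j=1}^n (1 − b/2 − b·f_j·(1/2 − y_j))/(1 − b/2 + b·f_j·(1/2 − y_j)) > (1 − b·x)/(1 − b + b·x). -/
/-- The ratio `(c - t) / (c + t)` at a sum is at most the product of the ratios. -/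
theorem sub_div_add_sum_le_prod {ι : Type*} (s : Finset ι) {c : ℝ} (hc : 0 < c) (t : ι → ℝ)
    (ht : ∀ i ∈ s, 0 ≤ t i) (hs : ∑ i ∈ s, t i ≤ c) :
    (c - ∑ i ∈ s, t i) / (c + ∑ i ∈ s, t i) ≤ ∏ i ∈ s, (c - t i) / (c + t i) := by
  classical
  induction s using Finset.induction_on with
  | empty => simp [hc.ne']
  | insert a s ha ih =>
    rw [Finset.sum_insert ha] at hs ⊢
    rw [Finset.prod_insert ha]
    have hta : 0 ≤ t a := ht a (Finset.mem_insert_self a s)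
    have hts : ∀ i ∈ s, 0 ≤ t i := fun i hi => ht i (Finset.mem_insert_of_mem hi)
    have hS : 0 ≤ ∑ i ∈ s, t i := Finset.sum_nonneg hts
    have hrec := ih hts (by linarith)
    have hfactor : 0 ≤ (c - t a) / (c + t a) := div_nonneg (by linarith) (by linarith)
    refine le_trans ?_ (mul_le_mul_of_nonneg_left hrec hfactor)
    generalize ∑ i ∈ s, t i = S at *
    rw [div_mul_div_comm, div_le_div_iff₀ (by positivity) (by positivity)]
    have hprod : 0 ≤ t a * S * (t a + S) := by positivity
    linarith

/-- The key analytic inequality underlying Theorem 1 of the paper: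
the product of the factors 1 − b_{I,j} strictly exceeds 1 − b_{II}. -/
theorem stmt_7 (b x : ℝ) (hb0 : 0 < b) (hb1 : b ≤ 1) (hx0 : 1/2 < x) (hx1 : x ≤ 1)
    (n : ℕ) (f : Fin n → ℝ) (hf0 : ∀ j, 0 ≤ f j) (hfsum : ∑ j, f j < 1)
    (y : Fin n → ℝ) (hy : ∀ j, 1 - x ≤ y j ∧ y j < 1/2) :
    ∏ j, (1 - b/2 - b * f j * (1/2 - y j)) / (1 - b/2 + b * f j * (1/2 - y j))
      > (1 - b * x) / (1 - b + b * x) := by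
  have hc : 0 < 1 - b / 2 := by linarith
  have hT : 0 < b * (x - 1 / 2) := mul_pos hb0 (by linarith)
  have hTc : b * (x - 1 / 2) ≤ 1 - b / 2 := by nlinarith
  have ht : ∀ j, 0 ≤ b * f j * (1 / 2 - y j) := fun j =>
    mul_nonneg (mul_nonneg hb0.le (hf0 j)) (by linarith [(hy j).2])
  have hsum : ∑ j, b * f j * (1 / 2 - y j) < b * (x - 1 / 2) := by
    calc ∑ j, b * f j * (1 / 2 - y j) ≤ ∑ j, f j * (b * (x - 1 / 2)) := by
          refine Finset.sum_le_sum fun j _ => ?_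
          have h := mul_le_mul_of_nonneg_left
            (show 1 / 2 - y j ≤ x - 1 / 2 by linarith [(hy j).1]) (mul_nonneg hb0.le (hf0 j))
          linarith
      _ = (∑ j, f j) * (b * (x - 1 / 2)) := (Finset.sum_mul _ _ _).symm
      _ < b * (x - 1 / 2) := mul_lt_of_lt_one_left hT hfsum
  have hS : 0 ≤ ∑ j, b * f j * (1 / 2 - y j) := Finset.sum_nonneg fun j _ => ht j
  refine lt_of_lt_of_le ?_ (sub_div_add_sum_le_prod Finset.univ hc
    (fun j => b * f j * (1 / 2 - y j)) (fun j _ => ht j) (by linarith))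
  rw [show 1 - b * x = 1 - b / 2 - b * (x - 1 / 2) by ring,
    show 1 - b + b * x = 1 - b / 2 + b * (x - 1 / 2) by ring,
    div_lt_div_iff₀ (by linarith) (by linarith)]
  linarith [mul_lt_mul_of_pos_left hsum hc]
end

section
/- Consider a one-level fractal ensemble of K ≥ 1 binary subtask classifiers with uniform belief parameter b ∈ (0,1], label-I training fractions f_1, …, f_K ≥ 0 with f_1 + ⋯ + f_K = 1 (each subtask uses all label-II data, i.e., its label-II fraction is 1), and sigmoid outputs x_1, …, x_K ∈ (0,1) on a given input. Define for each j: w_{I,j} = log(1 − (2·b·f_j·(1/2 − x_j))/(1 − b/2 + b·f_j·(1/2 − x_j))) if x_j < 1/2 and w_{I,j} = 0 otherwise; and w_{II,j} = log(1 − (2·b·(x_j − 1/2))/(1 − b/2 + b·(x_j − 1/2))) if x_j > 1/2 and w_{II,j} = 0 otherwise. Define the aggregated weights w_I = ∑_{j=1}^K w_{I,j} and w_{II} = min_{1 ≤ j ≤ K} w_{II,j}. If there exists an index i with f_i > 0, x_i > 1/2, and x_j ≥ 1 − x_i for all j ≠ i, then w_I > w_{II}, i.e., the ensemble accumulates strictly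 less evidence against label I than against label II and hence classifies the input as label I. -/
theorem log_one_add_sub_log_one_sub_le_mul {s t c : ℝ} (hc0 : 0 ≤ c) (hc1 : c ≤ 1)
    (ht0 : 0 ≤ t) (hts : t ≤ c * s) (hs0 : 0 ≤ s) (hs1 : s < 1) :
    Real.log (1 + t) - Real.log (1 - t) ≤ c * (Real.log (1 + s) - Real.log (1 - s)) := by
  have hts' : t ≤ s := hts.trans (mul_le_of_le_one_left hs0 hc1)
  have h_t := Real.hasSum_log_sub_log_of_abs_lt_one
    (abs_lt.2 ⟨by linarith, hts'.trans_lt hs1⟩)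
  have h_s := Real.hasSum_log_sub_log_of_abs_lt_one (abs_lt.2 ⟨by linarith, hs1⟩)
  refine hasSum_le (fun k => ?_) h_t (h_s.mul_left c)
  have h_pow : t ^ (2 * k + 1) ≤ c * s ^ (2 * k + 1) := by
    calc t ^ (2 * k + 1) ≤ (c * s) ^ (2 * k + 1) := by gcongr
      _ = c ^ (2 * k + 1) * s ^ (2 * k + 1) := mul_pow ..
      _ ≤ c * s ^ (2 * k + 1) := by
        gcongr
        exact pow_le_of_le_one hc0 hc1 (by lia)
  calc 2 * (1 / (2 * (k : ℝ) + 1)) * t ^ (2 * k + 1)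
      ≤ 2 * (1 / (2 * (k : ℝ) + 1)) * (c * s ^ (2 * k + 1)) := by gcongr
    _ = c * (2 * (1 / (2 * (k : ℝ) + 1)) * s ^ (2 * k + 1)) := by ring

theorem log_one_sub_two_mul_div_add {a t : ℝ} (ht0 : 0 ≤ t) (hta : t < a) :
    Real.log (1 - 2 * t / (a + t)) = -(Real.log (1 + t / a) - Real.log (1 - t / a)) := by
  have ha : 0 < a := ht0.trans_lt hta
  have h_sub : 0 < 1 - t / a := sub_pos.2 ((div_lt_one ha).2 hta)
  have h_add : 0 < 1 + t / a := by positivity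
  rw [neg_sub, ← Real.log_div h_sub.ne' h_add.ne']
  congr 1
  have : a + t ≠ 0 := by positivity
  field_simp
  ring

/-- The function `t ↦ log (1 - 2 t / (a + t))` on `[0, a)` is antitone, and lies above its chords
from the origin. -/
theorem mul_log_one_sub_le {a T t c : ℝ} (hc0 : 0 ≤ c) (hc1 : c ≤ 1)
    (ht0 : 0 ≤ t) (htT : t ≤ c * T) (hT0 : 0 ≤ T) (hTa : T < a) :
    c * Real.log (1 - 2 * T / (a + T)) ≤ Real.log (1 - 2 * t / (a + t)) := by
  have ha : 0 < a := hT0.trans_lt hTa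
  have hta : t < a := (htT.trans (mul_le_of_le_one_left hT0 hc1)).trans_lt hTa
  rw [log_one_sub_two_mul_div_add ht0 hta, log_one_sub_two_mul_div_add hT0 hTa, mul_neg,
    neg_le_neg_iff]
  refine log_one_add_sub_log_one_sub_le_mul hc0 hc1 (by positivity) ?_ (by positivity)
    ((div_lt_one ha).2 hTa)
  rw [← mul_div_assoc]
  gcongr

/-- Theorem 1 of the paper, specialized to a one-level fractal structure:
if some subtask classifier i with f_i > 0 has x_i > 1/2 and every other
subtask's sigmoid output satisfies x_j ≥ 1 − x_i, then the aggregated weight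
of evidence against label I strictly exceeds that against label II, so the
ensemble classifies the input as label I. -/
theorem stmt_9 (K : ℕ) (hK : 1 ≤ K) (b : ℝ) (hb0 : 0 < b) (hb1 : b ≤ 1)
    (f : Fin K → ℝ) (hf0 : ∀ j, 0 ≤ f j) (hfsum : ∑ j, f j = 1)
    (x : Fin K → ℝ) (hx : ∀ j, 0 < x j ∧ x j < 1)
    (wI wII : Fin K → ℝ)
    (hwI : ∀ j, wI j =
      if x j < 1/2 then
        Real.log (1 - (2 * b * f j * (1/2 - x j)) / (1 - b/2 + b * f j * (1/2 - x j)))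
      else 0)
    (hwII : ∀ j, wII j =
      if x j > 1/2 then
        Real.log (1 - (2 * b * (x j - 1/2)) / (1 - b/2 + b * (x j - 1/2)))
      else 0)
    (i : Fin K) (hfi : 0 < f i) (hxi : x i > 1/2)
    (hother : ∀ j, j ≠ i → x j ≥ 1 - x i) :
    haveI : Nonempty (Fin K) := ⟨⟨0, hK⟩⟩
    ∑ j, wI j > Finset.univ.inf' Finset.univ_nonempty wII := by
  have hx_lt := (hx i).2
  set a := 1 - b / 2 with ha
  set T := b * (x i - 1 / 2) with hT
  have hT0 : 0 < T := mul_pos hb0 (by linarith)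
  have hTa : T < a := by
    have : b * x i < b := mul_lt_of_lt_one_right hb0 hx_lt
    linarith
  have h_wII : wII i = Real.log (1 - 2 * T / (a + T)) := by
    rw [hwII, if_pos hxi, mul_assoc]
  have h_neg : wII i < 0 := by
    rw [h_wII]
    refine Real.log_neg ?_ ?_
    · rw [sub_pos, div_lt_one (by linarith)]
      linarith
    · have : 0 < 2 * T / (a + T) := div_pos (by linarith) (by linarith)
      linarith
  have h_f_le (j : Fin K) : f j ≤ 1 :=
    hfsum ▸ Finset.single_le_sum (fun k _ => hf0 k) (Finset.mem_univ j)
  have h_wI (j : Fin K) : f j * wII i ≤ wI j := by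
    rw [hwI]
    split_ifs with hj
    · have hji : j ≠ i := by
        rintro rfl
        linarith
      have h_le : 1 / 2 - x j ≤ x i - 1 / 2 := by linarith [hother j hji]
      have hbf : 0 ≤ b * f j := mul_nonneg hb0.le (hf0 j)
      rw [h_wII, show 2 * b * f j * (1 / 2 - x j) = 2 * (b * f j * (1 / 2 - x j)) by ring]
      refine mul_log_one_sub_le (hf0 j) (h_f_le j) (mul_nonneg hbf (by linarith)) ?_ hT0.le hTa
      calc b * f j * (1 / 2 - x j) ≤ b * f j * (x i - 1 / 2) := by gcongr
        _ = f j * T := by ring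
    · exact mul_nonpos_of_nonneg_of_nonpos (hf0 j) h_neg.le
  have h_wI_i : wI i = 0 := by rw [hwI, if_neg (by linarith)]
  refine (Finset.inf'_le wII (Finset.mem_univ i)).trans_lt ?_
  calc wII i = ∑ j, f j * wII i := by rw [← Finset.sum_mul, hfsum, one_mul]
    _ < ∑ j, wI j := Finset.sum_lt_sum (fun j _ => h_wI j)
        ⟨i, Finset.mem_univ i, h_wI_i ▸ mul_neg_of_pos_of_neg hfi h_neg⟩
end
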